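/- One has 2μ − 1 > 0, i.e., μ > 1/2. -/

import Mathlib

/-- `μ₁(α,β,γ) = (α+β+γ)/3 + (1−α)(1−β)(1−γ)`. -/
noncomputable def mu1 (a b g : ℝ) : ℝ := (a + b + g) / 3 + (1 - a) * (1 - b) * (1 - g)

/-- `μ₂(α,β,γ)`. -/
noncomputable def mu2 (a b g : ℝ) : ℝ :=
  (1 - a) * (1 - b) * (1 - g) + a * (1 - b) * (1 - g) + b * (1 - a) * (1 - g)
    + g * (1 - a) * (1 - b)
    + max 0 (a * b * (1 - g) - 2 / 3 * min a b)
    + max 0 (a * g * (1 - b) - 2 / 3 * min a g)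
    + max 0 (b * g * (1 - a) - 2 / 3 * min b g)

/-- `μ = min_{(α,β,γ)∈[0,1]³} max{μ₁(α,β,γ), μ₂(α,β,γ)}`. -/
noncomputable def muMin : ℝ :=
  sInf {x : ℝ | ∃ a ∈ Set.Icc (0 : ℝ) 1, ∃ b ∈ Set.Icc (0 : ℝ) 1, ∃ g ∈ Set.Icc (0 : ℝ) 1,
    x = max (mu1 a b g) (mu2 a b g)}

/-- If `μ₁` is close to `1/2`, the two smaller variables have a small sum. -/
theorem add_le_of_mu1_lt {a b g : ℝ} (ha : a ≤ 1) (hg : 0 ≤ g) (hgb : g ≤ b) (hba : b ≤ a)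
    (h : mu1 a b g < 51 / 100) : b + g < 53 / 100 := by
  unfold mu1 at h
  rcases le_total (1 / 3) ((1 - b) * (1 - g)) with hc | hc
  · nlinarith [mul_nonneg (sub_nonneg.2 ha) (sub_nonneg.2 hc)]
  · exfalso
    nlinarith [mul_nonneg (sub_nonneg.2 ha) (sub_nonneg.2 hc),
      sq_nonneg (b + g - 2 / 3), mul_nonneg hg (sub_nonneg.2 hgb),
      mul_nonneg hg (sub_nonneg.2 ha)]

theorem le_max_mu1_mu2_of_le {a b g : ℝ} (ha : a ≤ 1) (hg : 0 ≤ g) (hgb : g ≤ b) (hba : b ≤ a) :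
    51 / 100 ≤ max (mu1 a b g) (mu2 a b g) := by
  by_contra! h
  obtain ⟨h₁, h₂⟩ := max_lt_iff.1 h
  have hbg := add_le_of_mu1_lt ha hg hgb hba h₁
  unfold mu2 at h₂
  rw [min_eq_right hba] at h₂
  have hab := le_max_right 0 (a * b * (1 - g) - 2 / 3 * b)
  have hag := le_max_left 0 (a * g * (1 - b) - 2 / 3 * min a g)
  have hbg' := le_max_left 0 (b * g * (1 - a) - 2 / 3 * min b g)
  have hprod : 0 ≤ g * ((1 - a) * (1 - b)) :=
    mul_nonneg hg (mul_nonneg (by linarith) (by linarith))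
  linarith

theorem mu1_swap_left (a b g : ℝ) : mu1 a b g = mu1 b a g := by
  unfold mu1; ring

theorem mu1_swap_right (a b g : ℝ) : mu1 a b g = mu1 a g b := by
  unfold mu1; ring

theorem mu2_swap_left (a b g : ℝ) : mu2 a b g = mu2 b a g := by
  unfold mu2; rw [min_comm a b, mul_comm a b]; ring

theorem mu2_swap_right (a b g : ℝ) : mu2 a b g = mu2 a g b := by
  unfold mu2; rw [min_comm b g, mul_comm b g]; ring

theorem le_max_mu1_mu2 {a b g : ℝ} (ha : a ∈ Set.Icc (0 : ℝ) 1) (hb : b ∈ Set.Icc (0 : ℝ) 1)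
    (hg : g ∈ Set.Icc (0 : ℝ) 1) : 51 / 100 ≤ max (mu1 a b g) (mu2 a b g) := by
  rcases le_total a b with hab | hab <;> rcases le_total b g with hbg | hbg <;>
    rcases le_total a g with hag | hag
  · rw [mu1_swap_left, mu1_swap_right, mu1_swap_left, mu2_swap_left, mu2_swap_right,
      mu2_swap_left]
    exact le_max_mu1_mu2_of_le hg.2 ha.1 hab hbg
  · rw [mu1_swap_left, mu1_swap_right, mu1_swap_left, mu2_swap_left, mu2_swap_right,
      mu2_swap_left]
    exact le_max_mu1_mu2_of_le hg.2 ha.1 hab hbg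
  · rw [mu1_swap_left, mu1_swap_right, mu2_swap_left, mu2_swap_right]
    exact le_max_mu1_mu2_of_le hb.2 ha.1 hag hbg
  · rw [mu1_swap_left, mu2_swap_left]
    exact le_max_mu1_mu2_of_le hb.2 hg.1 hag hab
  · rw [mu1_swap_right, mu1_swap_left, mu2_swap_right, mu2_swap_left]
    exact le_max_mu1_mu2_of_le hg.2 hb.1 hab hag
  · rw [mu1_swap_right, mu2_swap_right]
    exact le_max_mu1_mu2_of_le ha.2 hb.1 hbg hag
  · exact le_max_mu1_mu2_of_le ha.2 hg.1 hbg hab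
  · exact le_max_mu1_mu2_of_le ha.2 hg.1 hbg hab

theorem le_muMin : 51 / 100 ≤ muMin := by
  refine le_csInf ⟨_, 0, by simp, 0, by simp, 0, by simp, rfl⟩ ?_
  rintro _ ⟨a, ha, b, hb, g, hg, rfl⟩
  exact le_max_mu1_mu2 ha hb hg

/-- **`2μ − 1 > 0`**, i.e. `μ > 1/2`. -/
theorem two_mu_sub_one_pos : 0 < 2 * muMin - 1 := by
  linarith [le_muMin]
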